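/- arXiv:2603.12530 — 4 statements merged into one kernel-verified Lean document; each statement's English description precedes it below -/
import Mathlib

section
/- Let S be a measurable space equipped with a probability measure ρ, let Θ be a set of vectors in ℝ^d, and for each x ∈ S let K(x) ⊆ ℝ^d be a nonempty set over which suprema of linear functionals are finite and attained. Let s : Θ × S → ℝ^d be a map, measurable and ρ-integrable in its second argument, such that s(θ,x) ∈ K(x) and ⟨s(θ,x), θ⟩ = sup_{a ∈ K(x)} ⟨a, θ⟩ for every θ ∈ Θ and x ∈ S (a greedy selector). Define g(θ) := ∫ s(θ,x) dρ(x). Then for every θ' ∈ Θ and every θ ∈ Θ it holds that ⟨g(θ), θ'⟩ ≤ ⟨g(θ'), θ'⟩; consequently ⟨g(θ'), θ'⟩ = sup_{θ ∈ Θ} ⟨g(θ), θ'⟩ and the supremum is attained at θ' itself. -/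
open MeasureTheory InnerProductSpace

theorem stmt_2 {d : ℕ} {S : Type*} [MeasurableSpace S]
    (ρ : Measure S) [IsProbabilityMeasure ρ]
    (Θ : Set (EuclideanSpace ℝ (Fin d)))
    (K : S → Set (EuclideanSpace ℝ (Fin d)))
    (hKne : ∀ x, (K x).Nonempty)
    (s : EuclideanSpace ℝ (Fin d) → S → EuclideanSpace ℝ (Fin d))
    (hmeas : ∀ θ ∈ Θ, Measurable (s θ))
    (hint : ∀ θ ∈ Θ, Integrable (s θ) ρ)
    (hmem : ∀ θ ∈ Θ, ∀ x, s θ x ∈ K x)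
    (hopt : ∀ θ ∈ Θ, ∀ x, ∀ a ∈ K x, ⟪a, θ⟫_ℝ ≤ ⟪s θ x, θ⟫_ℝ)
    (g : EuclideanSpace ℝ (Fin d) → EuclideanSpace ℝ (Fin d))
    (hg : ∀ θ, g θ = ∫ x, s θ x ∂ρ) :
    ∀ θ' ∈ Θ, (∀ θ ∈ Θ, ⟪g θ, θ'⟫_ℝ ≤ ⟪g θ', θ'⟫_ℝ) ∧
      IsGreatest ((fun θ => ⟪g θ, θ'⟫_ℝ) '' Θ) ⟪g θ', θ'⟫_ℝ := by
  intro θ' hθ'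
  have inner_g (θ) (hθ : θ ∈ Θ) : ⟪g θ, θ'⟫_ℝ = ∫ x, ⟪s θ x, θ'⟫_ℝ ∂ρ := by
    simp_rw [hg, real_inner_comm θ']
    exact (integral_inner (hint θ hθ) θ').symm
  have g_le (θ) (hθ : θ ∈ Θ) : ⟪g θ, θ'⟫_ℝ ≤ ⟪g θ', θ'⟫_ℝ := by
    rw [inner_g θ hθ, inner_g θ' hθ']
    exact integral_mono ((hint θ hθ).inner_const θ') ((hint θ' hθ').inner_const θ')
      fun x => hopt θ' hθ' x _ (hmem θ hθ x)
  exact ⟨g_le, ⟨θ', hθ', rfl⟩, Set.forall_mem_image.2 g_le⟩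
end

section
/- Let (Ω, F, μ) be a probability space with a filtration (G_t)_{t ∈ ℕ}, let τ ≥ 1 and T > τ be integers, and let (b_t)_{t ∈ ℕ} be real random variables with |b_t| ≤ 2 almost surely and b_t measurable with respect to G_{t+τ} for every t. Then for every δ ∈ (0,1), with probability at least 1 − δ, | Σ_{t=τ}^{T} ( b_t − E[ b_t | G_t ] ) | ≤ 4·√( 2·T·τ·log(2τ/δ) ). -/
open MeasureTheory

open ProbabilityTheory Finset
open scoped NNReal

/-- The chord bound for the exponential on `[-K, K]`. -/
lemma Real.exp_mul_le_cosh_add_sinh {K x : ℝ} (hK : 0 < K) (hx : |x| ≤ K) (s : ℝ) :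
    Real.exp (s * x) ≤ Real.cosh (s * K) + x * (Real.sinh (s * K) / K) := by
  obtain ⟨h₁, h₂⟩ := abs_le.1 hx
  have hp : 0 ≤ (K + x) / (2 * K) := div_nonneg (by linarith) (by linarith)
  have hq : 0 ≤ (K - x) / (2 * K) := div_nonneg (by linarith) (by linarith)
  have h := convexOn_exp.2 (Set.mem_univ (s * K)) (Set.mem_univ (-(s * K))) hp hq
    (by field_simp; ring)
  have harg : (K + x) / (2 * K) * (s * K) + (K - x) / (2 * K) * -(s * K) = s * x := by
    field_simp; ring
  simp only [smul_eq_mul] at h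
  rw [harg] at h
  refine h.trans_eq ?_
  rw [Real.cosh_eq, Real.sinh_eq]
  field_simp
  ring

namespace ProbabilityTheory.HasSubgaussianMGF

variable {Ω : Type*} {m0 : MeasurableSpace Ω} {μ : Measure Ω}

lemma mono {X : Ω → ℝ} {c c' : ℝ≥0} (h : HasSubgaussianMGF X c μ) (hc : c ≤ c') :
    HasSubgaussianMGF X c' μ where
  integrable_exp_mul := h.integrable_exp_mul
  mgf_le t := (h.mgf_le t).trans (by gcongr)

/-- The sum of a sub-Gaussian variable measurable with respect to `m` and a variable bounded by `K`
whose conditional expectation given `m` vanishes. -/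
lemma add_of_condExp_eq_zero [IsFiniteMeasure μ] {m : MeasurableSpace Ω} (hm : m ≤ m0)
    {S X : Ω → ℝ} {c K : ℝ≥0} (hK : 0 < K) (hS : HasSubgaussianMGF S c μ)
    (hSm : StronglyMeasurable[m] S) (hXm : AEStronglyMeasurable[m0] X μ)
    (hX : ∀ᵐ ω ∂μ, |X ω| ≤ K) (hX0 : μ[X | m] =ᵐ[μ] 0) :
    HasSubgaussianMGF (fun ω ↦ S ω + X ω) (c + K ^ 2) μ := by
  have hXint : Integrable X μ := .of_bound hXm K (by simpa using hX)
  have hdom (t : ℝ) : ∀ᵐ ω ∂μ, Real.exp (t * (S ω + X ω)) ≤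
      Real.cosh (t * K) * Real.exp (t * S ω) +
        Real.sinh (t * K) / K * (Real.exp (t * S ω) * X ω) := by
    filter_upwards [hX] with ω hω
    rw [mul_add, Real.exp_add]
    calc _ ≤ Real.exp (t * S ω) * (Real.cosh (t * K) + X ω * (Real.sinh (t * K) / K)) := by
          gcongr
          exact Real.exp_mul_le_cosh_add_sinh (by exact_mod_cast hK) hω t
      _ = _ := by ring
  have hprod (t : ℝ) : Integrable (fun ω ↦ Real.exp (t * S ω) * X ω) μ :=
    (hS.integrable_exp_mul t).mul_bdd hXm (by simpa using hX)
  have hbound (t : ℝ) := ((hS.integrable_exp_mul t).const_mul (Real.cosh (t * K))).add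
    ((hprod t).const_mul (Real.sinh (t * K) / K))
  have hint (t : ℝ) : Integrable (fun ω ↦ Real.exp (t * (S ω + X ω))) μ := by
    refine (hbound t).mono' ?_ ?_
    · exact Real.continuous_exp.comp_aestronglyMeasurable
        ((hS.aestronglyMeasurable.add hXm).const_mul t)
    · filter_upwards [hdom t] with ω hω
      simpa [Real.norm_eq_abs] using hω
  have hzero (t : ℝ) : ∫ ω, Real.exp (t * S ω) * X ω ∂μ = 0 := by
    have hZ : StronglyMeasurable[m] (fun ω ↦ Real.exp (t * S ω)) :=
      Real.continuous_exp.comp_stronglyMeasurable (hSm.const_mul t)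
    rw [← integral_condExp hm]
    refine integral_eq_zero_of_ae ?_
    filter_upwards [condExp_mul_of_stronglyMeasurable_left hZ (hprod t) hXint, hX0] with ω h₁ h₂
    refine h₁.trans ?_
    simp [h₂]
  refine ⟨hint, fun t ↦ ?_⟩
  calc mgf (fun ω ↦ S ω + X ω) μ t
      ≤ ∫ ω, (Real.cosh (t * K) * Real.exp (t * S ω) +
        Real.sinh (t * K) / K * (Real.exp (t * S ω) * X ω)) ∂μ :=
        integral_mono_ae (hint t) (hbound t) (hdom t)
    _ = Real.cosh (t * K) * mgf S μ t := by
        rw [integral_add ((hS.integrable_exp_mul t).const_mul _) ((hprod t).const_mul _),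
          integral_const_mul, integral_const_mul, hzero, mul_zero, add_zero, mgf]
    _ ≤ Real.exp ((t * K) ^ 2 / 2) * Real.exp (c * t ^ 2 / 2) := by
        gcongr
        · exact mgf_nonneg
        · exact Real.cosh_le_exp_half_sq _
        · exact hS.mgf_le t
    _ = Real.exp ((c + K ^ 2 : ℝ≥0) * t ^ 2 / 2) := by
        rw [← Real.exp_add]
        push_cast
        ring_nf

/-- Sums of arbitrarily dependent sub-Gaussian variables. -/
lemma finset_sum [IsZeroOrProbabilityMeasure μ] {ι : Type*} (s : Finset ι) {X : ι → Ω → ℝ}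
    {c : ι → ℝ≥0} (h : ∀ i ∈ s, HasSubgaussianMGF (X i) (c i) μ) :
    HasSubgaussianMGF (fun ω ↦ ∑ i ∈ s, X i ω) ((∑ i ∈ s, (c i).sqrt) ^ 2) μ := by
  classical
  induction s using Finset.induction_on with
  | empty => simp
  | insert i s hi ih =>
    have := (h i (mem_insert_self i s)).add (ih fun j hj ↦ h j (mem_insert_of_mem hj))
    simpa [sum_insert hi, NNReal.sqrt_sq] using this

/-- **Azuma–Hoeffding** along an index set whose elements are at distance at least `τ`, for
conditionally centered variables that become measurable after a delay of `τ`. -/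
lemma sum_of_delayed [IsProbabilityMeasure μ] (G : Filtration ℕ m0) {τ : ℕ} {X : ℕ → Ω → ℝ}
    {K : ℝ≥0} (hK : 0 < K) (hXm : ∀ t, StronglyMeasurable[G (t + τ)] (X t))
    (hX : ∀ t, ∀ᵐ ω ∂μ, |X t ω| ≤ K) (hX0 : ∀ t, μ[X t | G t] =ᵐ[μ] 0) (A : Finset ℕ)
    (hA : ∀ s ∈ A, ∀ t ∈ A, s < t → s + τ ≤ t) :
    HasSubgaussianMGF (fun ω ↦ ∑ t ∈ A, X t ω) (#A * K ^ 2) μ := by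
  induction A using Finset.induction_on_max with
  | empty => simp
  | insert t A hmax ih =>
    have htA : t ∉ A := fun h ↦ (hmax t h).false
    have hS := ih fun s hs u hu ↦ hA s (mem_insert_of_mem hs) u (mem_insert_of_mem hu)
    have hSm : StronglyMeasurable[G t] (fun ω ↦ ∑ s ∈ A, X s ω) :=
      Finset.stronglyMeasurable_fun_sum A fun s hs ↦ (hXm s).mono <|
        G.mono (hA s (mem_insert_of_mem hs) t (mem_insert_self t A) (hmax s hs))
    have := hS.add_of_condExp_eq_zero (G.le t) hK hSm
      ((hXm t).mono (G.le _)).aestronglyMeasurable (hX t) (hX0 t)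
    convert this using 1
    · ext ω
      rw [sum_insert htA, add_comm]
    · rw [card_insert_of_notMem htA]
      push_cast
      ring

/-- Sums over an arbitrary index set, split into residue classes modulo the delay. -/
lemma sum_of_delayed_interleaved [IsProbabilityMeasure μ] (G : Filtration ℕ m0) {τ : ℕ}
    (hτ : 0 < τ) {X : ℕ → Ω → ℝ} {K : ℝ≥0} (hK : 0 < K)
    (hXm : ∀ t, StronglyMeasurable[G (t + τ)] (X t))
    (hX : ∀ t, ∀ᵐ ω ∂μ, |X t ω| ≤ K) (hX0 : ∀ t, μ[X t | G t] =ᵐ[μ] 0) (A : Finset ℕ) :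
    HasSubgaussianMGF (fun ω ↦ ∑ t ∈ A, X t ω) (τ * (#A * K ^ 2)) μ := by
  have hmaps : ∀ t ∈ A, t % τ ∈ range τ := fun t _ ↦ mem_range.2 (Nat.mod_lt t hτ)
  have h := finset_sum (range τ) fun r _ ↦
    sum_of_delayed G hK hXm hX hX0 {t ∈ A | t % τ = r} fun s hs t ht hst ↦ by
      have hmod : s ≡ t [MOD τ] := (mem_filter.1 hs).2.trans (mem_filter.1 ht).2.symm
      have := Nat.le_of_dvd (by omega) ((Nat.modEq_iff_dvd' hst.le).1 hmod)
      omega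
  simp only [sum_fiberwise_of_maps_to hmaps] at h
  refine h.mono ?_
  have hcs := sq_sum_le_card_mul_sum_sq (s := range τ)
    (f := fun r ↦ (#{t ∈ A | t % τ = r} * K ^ 2 : ℝ≥0).sqrt)
  simp only [NNReal.sq_sqrt, card_range, ← sum_mul] at hcs
  rwa [← Nat.cast_sum, ← card_eq_sum_card_fiberwise hmaps] at hcs

/-- The two-sided Chernoff bound. -/
lemma one_sub_le_measureReal_abs_le [IsProbabilityMeasure μ] {X : Ω → ℝ} {c : ℝ≥0}
    (h : HasSubgaussianMGF X c μ) {ε : ℝ} (hε : 0 ≤ ε) :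
    1 - 2 * Real.exp (-ε ^ 2 / (2 * c)) ≤ μ.real {ω | |X ω| ≤ ε} := by
  have hcover : (Set.univ : Set Ω) ⊆
      {ω | |X ω| ≤ ε} ∪ ({ω | ε ≤ X ω} ∪ {ω | ε ≤ (-X) ω}) := by
    intro ω _
    rcases le_or_gt |X ω| ε with hω | hω
    · exact .inl hω
    · exact .inr ((lt_abs.1 hω).imp le_of_lt le_of_lt)
  have h₀ := measureReal_mono (μ := μ) hcover
  rw [probReal_univ] at h₀
  have h₁ := measureReal_union_le (μ := μ) {ω | |X ω| ≤ ε} ({ω | ε ≤ X ω} ∪ {ω | ε ≤ (-X) ω})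
  have h₂ := measureReal_union_le (μ := μ) {ω | ε ≤ X ω} {ω | ε ≤ (-X) ω}
  linarith [h.measure_ge_le hε, h.neg.measure_ge_le hε]

end ProbabilityTheory.HasSubgaussianMGF

theorem stmt_10 {Ω : Type*} {m0 : MeasurableSpace Ω}
    (μ : Measure Ω) [IsProbabilityMeasure μ]
    (G : Filtration ℕ m0) (τ T : ℕ) (hτ : 1 ≤ τ) (hT : τ < T)
    (b : ℕ → Ω → ℝ)
    (hb : ∀ t, ∀ᵐ ω ∂μ, |b t ω| ≤ 2)
    (hmeas : ∀ t, StronglyMeasurable[G (t + τ)] (b t)) :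
    ∀ δ : ℝ, 0 < δ → δ < 1 →
      (μ {ω | |∑ t ∈ Finset.Icc τ T, (b t ω - (μ[b t | G t]) ω)| ≤
          4 * Real.sqrt (2 * T * τ * Real.log (2 * τ / δ))}).toReal ≥ 1 - δ := by
  intro δ hδ hδ1
  have hbint (t : ℕ) : Integrable (b t) μ :=
    .of_bound ((hmeas t).mono (G.le _)).aestronglyMeasurable 2 (hb t)
  have hXm (t : ℕ) : StronglyMeasurable[G (t + τ)] (fun ω ↦ b t ω - (μ[b t | G t]) ω) :=
    (hmeas t).sub (stronglyMeasurable_condExp.mono (G.mono (Nat.le_add_right t τ)))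
  have hX (t : ℕ) : ∀ᵐ ω ∂μ, |b t ω - (μ[b t | G t]) ω| ≤ (4 : ℝ≥0) := by
    filter_upwards [hb t, ae_bdd_abs_condExp_of_ae_bdd_abs (m := G t) (hb t)] with ω h₁ h₂
    have := abs_sub (b t ω) ((μ[b t | G t]) ω)
    push_cast
    linarith
  have hX0 (t : ℕ) : μ[fun ω ↦ b t ω - (μ[b t | G t]) ω | G t] =ᵐ[μ] 0 := by
    filter_upwards [condExp_sub (hbint t) integrable_condExp (G t),
      condExp_condExp_of_le (μ := μ) (f := b t) le_rfl (G.le t)] with ω h₁ h₂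
    refine h₁.trans ?_
    simp [h₂]
  have hcard : #(Icc τ T) ≤ T := by
    rw [Nat.card_Icc]
    omega
  have hsub : HasSubgaussianMGF (fun ω ↦ ∑ t ∈ Icc τ T, (b t ω - (μ[b t | G t]) ω))
      (τ * (T * 4 ^ 2)) μ :=
    (HasSubgaussianMGF.sum_of_delayed_interleaved G hτ (by norm_num) hXm hX hX0 (Icc τ T)).mono
      (by gcongr)
  have hτ' : (1 : ℝ) ≤ τ := by exact_mod_cast hτ
  have hT' : (0 : ℝ) < T := by exact_mod_cast (Nat.zero_le τ).trans_lt hT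
  have hlog : 0 ≤ Real.log (2 * τ / δ) :=
    Real.log_nonneg ((one_le_div hδ).2 (by linarith))
  have hexp : Real.exp (-(4 * Real.sqrt (2 * T * τ * Real.log (2 * τ / δ))) ^ 2 /
      (2 * ((τ * (T * 4 ^ 2) : ℝ≥0) : ℝ))) = δ / (2 * τ) := by
    have : -(4 * Real.sqrt (2 * T * τ * Real.log (2 * τ / δ))) ^ 2 /
        (2 * ((τ * (T * 4 ^ 2) : ℝ≥0) : ℝ)) = -Real.log (2 * τ / δ) := by
      rw [mul_pow, Real.sq_sqrt (by positivity)]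
      push_cast
      field_simp
    rw [this, Real.exp_neg, Real.exp_log (by positivity), inv_div]
  have hmain := hsub.one_sub_le_measureReal_abs_le
    (ε := 4 * Real.sqrt (2 * T * τ * Real.log (2 * τ / δ))) (by positivity)
  rw [hexp] at hmain
  have hδτ : 2 * (δ / (2 * τ)) ≤ δ := by
    have : 2 * (δ / (2 * τ)) = δ / τ := by field_simp
    rw [this]
    exact div_le_self hδ.le hτ'
  exact (sub_le_sub_left hδτ 1).trans hmain
end

section
/- Consider the context-Markovian linear bandit setting: (A_t)_{t ≥ 1} is a Markov chain on a standard Borel space S with kernel P, uniformly geometrically ergodic with constants C_mix < ∞, β ∈ (0,1) and stationary distribution π. Each state x ∈ S carries a nonempty compact context set K(x) ⊆ {a ∈ ℝ^d : ‖a‖₂ ≤ 1}; a measurable greedy selector s : Θ × S → ℝ^d satisfies s(θ,x) ∈ K(x) and ⟨s(θ,x),θ⟩ = max_{a ∈ K(x)}⟨a,θ⟩; Θ ⊆ {θ : ‖θ‖₂ ≤ 1}; and g_π(θ) := E_{x∼π}[s(θ,x)]. Let Θ' ⊆ Θ be a finite (1/T)-net of Θ, let M ≥ 1, δ ∈ (0,1),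 and let n ≥ 1. Define the empirical surrogate map g^{(n)}(θ) := (1/n)·Σ_{t=1}^{n} s(θ, A_t). Then with probability at least 1 − δ/M, simultaneously for all θ ∈ Θ' and all θ' ∈ Θ: | ⟨g_π(θ), θ'⟩ − ⟨g^{(n)}(θ), θ'⟩ | ≤ √( 36·log(4·C_mix)·log(2·M·|Θ'|/δ) / ((1−β)·n) ) + 2·C_mix/((1−β)·n) + 2/T. -/
open MeasureTheory ProbabilityTheory InnerProductSpace

/-- Total variation distance between two measures:
`TV(ρ, ρ') = sup_{A measurable} |ρ(A) − ρ'(A)|`. -/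
noncomputable def tvDist {S : Type*} [MeasurableSpace S]
    (ρ ρ' : Measure S) : ℝ :=
  ⨆ B : {B : Set S // MeasurableSet B}, |(ρ B.1).toReal - (ρ' B.1).toReal|

/-- `t`-step pushforward of a measure under a Markov kernel. -/
noncomputable def iterPush {S : Type*} [MeasurableSpace S] (P : Kernel S S) :
    ℕ → Measure S → Measure S
  | 0, ν => ν
  | t + 1, ν => (iterPush P t ν).bind (fun x => P x)

/-- The σ-algebra generated by `A 1, …, A t`. -/
def histSigmaA {Ω S : Type*} [MeasurableSpace S]
    (A : ℕ → Ω → S) (t : ℕ) : MeasurableSpace Ω :=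
  ⨆ s ∈ Finset.Icc 1 t, MeasurableSpace.comap (A s) inferInstance

section
variable {S : Type*} [MeasurableSpace S]

theorem exists_affine_hoeffding {a b : ℝ} (hab : a ≤ b) (l : ℝ) :
    ∃ p q : ℝ, (∀ x ∈ Set.Icc a b, Real.exp (l * x) ≤ p + q * x) ∧
      ∀ z ∈ Set.Icc a b, p + q * z ≤ Real.exp (l * z + l ^ 2 * (b - a) ^ 2 / 8) := by
  rcases hab.eq_or_lt with rfl | hlt
  · refine ⟨Real.exp (l * a), 0, fun x hx => ?_, fun x hx => ?_⟩ <;>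
      obtain rfl : x = a := le_antisymm hx.2 hx.1 <;> simp
  have hd : 0 < b - a := sub_pos.2 hlt
  have key : ∀ z, (b * Real.exp (l * a) - a * Real.exp (l * b)) / (b - a) +
      (Real.exp (l * b) - Real.exp (l * a)) / (b - a) * z =
      (b - z) / (b - a) * Real.exp (l * a) + (z - a) / (b - a) * Real.exp (l * b) := by
    intro z; field_simp; ring
  refine ⟨(b * Real.exp (l * a) - a * Real.exp (l * b)) / (b - a),
    (Real.exp (l * b) - Real.exp (l * a)) / (b - a), fun x hx => ?_, fun z hz => ?_⟩
  · rw [key]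
    have h := convexOn_exp.2 (Set.mem_univ (l * a)) (Set.mem_univ (l * b))
      (div_nonneg (sub_nonneg.2 hx.2) hd.le) (div_nonneg (sub_nonneg.2 hx.1) hd.le)
      (by field_simp; ring)
    simp only [smul_eq_mul] at h
    have e : (b - x) / (b - a) * (l * a) + (x - a) / (b - a) * (l * b) = l * x := by
      field_simp; ring
    rwa [e] at h
  · rw [key]
    set u := (b - z) / (b - a) with hu
    set v := (z - a) / (b - a) with hv
    have hu0 : 0 ≤ u := div_nonneg (sub_nonneg.2 hz.2) hd.le
    have hv0 : 0 ≤ v := div_nonneg (sub_nonneg.2 hz.1) hd.le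
    have huv : u + v = 1 := by rw [hu, hv]; field_simp; ring
    have hmean : u * a + v * b = z := by rw [hu, hv]; field_simp; ring
    let ν : Measure ℝ := ENNReal.ofReal u • Measure.dirac a + ENNReal.ofReal v • Measure.dirac b
    have hint : ∀ f : ℝ → ℝ, ∫ x, f x ∂ν = u * f a + v * f b := by
      intro f
      have h1 : ∀ c : ℝ, Integrable f (Measure.dirac c) := fun c =>
        integrable_dirac (by simp)
      rw [integral_add_measure ((h1 a).smul_measure (by simp)) ((h1 b).smul_measure (by simp))]
      simp [integral_smul_measure, hu0, hv0]
    have hprob : IsProbabilityMeasure ν := ⟨by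
      simp [ν, ← ENNReal.ofReal_add hu0 hv0, huv]⟩
    have hsub := (hasSubgaussianMGF_of_mem_Icc (μ := ν) (X := id) (a := a) (b := b)
      aemeasurable_id (by
        simp only [ν, ae_add_measure_iff]
        refine ⟨Measure.ae_smul_measure ?_ _, Measure.ae_smul_measure ?_ _⟩ <;>
          rw [ae_dirac_eq] <;> simp [hlt.le])).mgf_le l
    simp only [mgf, hint, id, hmean] at hsub
    have e : ∀ c, Real.exp (l * c) = Real.exp (l * z) * Real.exp (l * (c - z)) := by
      intro c; rw [← Real.exp_add]; ring_nf
    rw [e a, e b, Real.exp_add]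
    calc _ = Real.exp (l * z) * (u * Real.exp (l * (a - z)) + v * Real.exp (l * (b - z))) := by ring
      _ ≤ _ := by
        gcongr
        refine hsub.trans_eq ?_
        congr 1
        simp
        rw [abs_of_pos hd]; ring

theorem abs_measureReal_sub_le_tvDist (ρ ρ' : Measure S) [IsProbabilityMeasure ρ]
    [IsProbabilityMeasure ρ'] {B : Set S} (hB : MeasurableSet B) :
    |ρ.real B - ρ'.real B| ≤ tvDist ρ ρ' := by
  refine le_ciSup (f := fun B : {B : Set S // MeasurableSet B} =>
    |(ρ B.1).toReal - (ρ' B.1).toReal|) ⟨1, ?_⟩ ⟨B, hB⟩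
  rintro _ ⟨B, rfl⟩
  have h1 := measureReal_nonneg (μ := ρ) (s := B.1)
  have h2 := measureReal_nonneg (μ := ρ') (s := B.1)
  have h3 := measureReal_le_one (μ := ρ) (s := B.1)
  have h4 := measureReal_le_one (μ := ρ') (s := B.1)
  simp only [Measure.real] at h1 h2 h3 h4
  exact abs_le.2 ⟨by linarith, by linarith⟩

theorem abs_integral_sub_le_two_mul_tvDist (ρ ρ' : Measure S) [IsProbabilityMeasure ρ]
    [IsProbabilityMeasure ρ'] {f : S → ℝ} (hf : Measurable f) (hb : ∀ x, |f x| ≤ 1) :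
    |∫ x, f x ∂ρ - ∫ x, f x ∂ρ'| ≤ 2 * tvDist ρ ρ' := by
  have htv := fun B (hB : MeasurableSet B) => abs_measureReal_sub_le_tvDist ρ ρ' hB
  have hi : ∀ (κ : Measure S) [IsFiniteMeasure κ] (g : S → ℝ), Measurable g → (∀ x, |g x| ≤ 1) →
      Integrable g κ := fun κ _ g hg hgb =>
    Integrable.of_bound hg.aestronglyMeasurable 1 (ae_of_all _ hgb)
  have key : ∀ (ρ ρ' : Measure S) [IsProbabilityMeasure ρ] [IsProbabilityMeasure ρ'] (g : S → ℝ),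
      Measurable g → (∀ x, |g x| ≤ 1) → (∀ B, MeasurableSet B → |ρ.real B - ρ'.real B| ≤
        tvDist ρ ρ') →
      ∫ x, g x ∂ρ - ∫ x, g x ∂ρ' ≤ 2 * tvDist ρ ρ' := by
    intro ρ ρ' _ _ g hg hgb htv
    obtain ⟨s, hs, h1, h2⟩ := hahn_decomposition ρ ρ'
    have r1 : ρ'.restrict s ≤ ρ.restrict s := by
      refine Measure.le_iff.2 fun t ht => ?_
      rw [Measure.restrict_apply ht, Measure.restrict_apply ht]
      exact h1 _ (ht.inter hs) Set.inter_subset_right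
    have r2 : ρ.restrict sᶜ ≤ ρ'.restrict sᶜ := by
      refine Measure.le_iff.2 fun t ht => ?_
      rw [Measure.restrict_apply ht, Measure.restrict_apply ht]
      exact h2 _ (ht.inter hs.compl) Set.inter_subset_right
    have i1 := integral_mono_measure (f := fun x => 1 - g x) r1
      (ae_of_all _ fun x => by have := abs_le.1 (hgb x); simp; linarith)
      ((integrable_const _).sub (hi _ g hg hgb))
    have i2 := integral_mono_measure (f := fun x => g x + 1) r2
      (ae_of_all _ fun x => by have := abs_le.1 (hgb x); simp; linarith)
      ((hi _ g hg hgb).add (integrable_const _))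
    rw [integral_sub (integrable_const _) (hi _ g hg hgb),
      integral_sub (integrable_const _) (hi _ g hg hgb)] at i1
    rw [integral_add (hi _ g hg hgb) (integrable_const _),
      integral_add (hi _ g hg hgb) (integrable_const _)] at i2
    simp only [integral_const, smul_eq_mul, mul_one, measureReal_restrict_apply_univ] at i1 i2
    rw [← integral_add_compl hs (hi ρ g hg hgb), ← integral_add_compl hs (hi ρ' g hg hgb)]
    have c1 := probReal_compl_eq_one_sub (μ := ρ) hs
    have c2 := probReal_compl_eq_one_sub (μ := ρ') hs
    have := (abs_le.1 (htv s hs)).2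
    linarith
  have k1 := key ρ ρ' f hf hb htv
  have k2 := key ρ ρ' (fun x => - f x) hf.neg (by simpa using hb) htv
  simp only [integral_neg] at k2
  exact abs_le.2 ⟨by linarith, by linarith⟩

end

section
variable {Ω : Type*} {m m0 : MeasurableSpace Ω} {μ : Measure Ω} [IsProbabilityMeasure μ]

/-- The exponential moment of a bounded martingale increment, weighted by the past. -/
theorem integral_mul_exp_sub_condExp_le (hm : m ≤ m0) {X Z W : Ω → ℝ} {a b l : ℝ}
    (hab : a ≤ b) (hX : AEStronglyMeasurable X μ) (hXab : ∀ᵐ ω ∂μ, X ω ∈ Set.Icc a b)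
    (hZ : Z =ᵐ[μ] μ[X | m]) (hZm : StronglyMeasurable[m] Z)
    (hWm : StronglyMeasurable[m] W) (hW0 : ∀ ω, 0 ≤ W ω) (hWi : Integrable W μ) :
    Integrable (fun ω => W ω * Real.exp (l * (X ω - Z ω))) μ ∧
      ∫ ω, W ω * Real.exp (l * (X ω - Z ω)) ∂μ ≤
        Real.exp (l ^ 2 * (b - a) ^ 2 / 8) * ∫ ω, W ω ∂μ := by
  have hXi : Integrable X μ := Integrable.of_mem_Icc a b hX.aemeasurable hXab
  have hZab : ∀ᵐ ω ∂μ, Z ω ∈ Set.Icc a b := by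
    have h1 : μ[fun _ => a | m] ≤ᵐ[μ] μ[X | m] :=
      condExp_mono (integrable_const _) hXi (hXab.mono fun _ h => h.1)
    have h2 : μ[X | m] ≤ᵐ[μ] μ[fun _ => b | m] :=
      condExp_mono hXi (integrable_const _) (hXab.mono fun _ h => h.2)
    rw [condExp_const hm] at h1 h2
    filter_upwards [h1, h2, hZ] with ω h1 h2 h3
    rw [h3]; exact ⟨h1, h2⟩
  obtain ⟨p, q, hpq1, hpq2⟩ := exists_affine_hoeffding hab l
  set U : Ω → ℝ := fun ω => W ω * Real.exp (-(l * Z ω)) with hU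
  have hUm : StronglyMeasurable[m] U := by
    refine hWm.mul ?_
    exact Real.continuous_exp.comp_stronglyMeasurable ((hZm.const_mul l).neg)
  set R := max |a| |b|
  have habs : ∀ x ∈ Set.Icc a b, |x| ≤ R := fun x hx => abs_le_max_abs_abs hx.1 hx.2
  have hexp : ∀ x, |x| ≤ R → Real.exp (l * x) ≤ Real.exp (|l| * R) := fun x hx =>
    Real.exp_le_exp.2 ((le_abs_self _).trans (by rw [abs_mul]; gcongr))
  have hUi : Integrable U μ := by
    refine hWi.mul_bdd (c := Real.exp (|l| * R)) ?_ ?_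
    · exact ((Real.continuous_exp.comp_stronglyMeasurable
        ((hZm.const_mul l).neg)).mono hm).aestronglyMeasurable
    · filter_upwards [hZab] with ω h
      rw [Real.norm_eq_abs, Real.abs_exp, ← mul_neg]
      exact hexp _ (by rw [abs_neg]; exact habs _ h)
  have hUXi : Integrable (fun ω => U ω * X ω) μ := hUi.mul_bdd (c := R) hX
    (hXab.mono fun ω h => habs _ h)
  have hUZi : Integrable (fun ω => U ω * Z ω) μ := hUi.mul_bdd (c := R)
    (hZm.mono hm).aestronglyMeasurable (hZab.mono fun ω h => habs _ h)
  have hUX : ∫ ω, U ω * X ω ∂μ = ∫ ω, U ω * Z ω ∂μ := by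
    rw [← integral_condExp hm (f := fun ω => U ω * X ω)]
    refine integral_congr_ae ?_
    filter_upwards [condExp_mul_of_stronglyMeasurable_left hUm hUXi hXi, hZ] with ω h1 h2
    rw [h2]; exact h1
  have hrew : (fun ω => W ω * Real.exp (l * (X ω - Z ω))) =
      fun ω => U ω * Real.exp (l * X ω) := by
    funext ω
    rw [hU]; simp only; rw [mul_assoc, ← Real.exp_add]; ring_nf
  have hI : Integrable (fun ω => U ω * Real.exp (l * X ω)) μ := by
    refine hUi.mul_bdd (c := Real.exp (|l| * R)) ?_ ?_
    · exact Real.continuous_exp.comp_aestronglyMeasurable (hX.const_mul l)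
    · filter_upwards [hXab] with ω h
      rw [Real.norm_eq_abs, Real.abs_exp]
      exact hexp _ (habs _ h)
  have hU0 : ∀ ω, 0 ≤ U ω := fun ω => mul_nonneg (hW0 ω) (Real.exp_nonneg _)
  rw [hrew]
  refine ⟨hI, ?_⟩
  calc ∫ ω, U ω * Real.exp (l * X ω) ∂μ ≤ ∫ ω, p * U ω + q * (U ω * X ω) ∂μ := by
        refine integral_mono_ae hI ((hUi.const_mul p).add (hUXi.const_mul q)) ?_
        filter_upwards [hXab] with ω h
        have := mul_le_mul_of_nonneg_left (hpq1 _ h) (hU0 ω)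
        linarith
    _ = ∫ ω, p * U ω + q * (U ω * Z ω) ∂μ := by
        rw [integral_add (hUi.const_mul p) (hUXi.const_mul q),
          integral_add (hUi.const_mul p) (hUZi.const_mul q), integral_const_mul,
          integral_const_mul, integral_const_mul, hUX]
    _ ≤ ∫ ω, Real.exp (l ^ 2 * (b - a) ^ 2 / 8) * W ω ∂μ := by
        refine integral_mono_ae ((hUi.const_mul p).add (hUZi.const_mul q)) (hWi.const_mul _) ?_
        filter_upwards [hZab] with ω h
        have := mul_le_mul_of_nonneg_left (hpq2 _ h) (hU0 ω)
        have e : U ω * Real.exp (l * Z ω + l ^ 2 * (b - a) ^ 2 / 8) =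
            Real.exp (l ^ 2 * (b - a) ^ 2 / 8) * W ω := by
          rw [hU]; simp only; rw [mul_assoc, ← Real.exp_add, mul_comm]; ring_nf
        linarith
    _ = _ := integral_const_mul _ _

/-- Azuma–Hoeffding for a Doob martingale whose increments have ranges of width `√(v j)` around
predictable centres. -/
theorem doob_integral_exp_le (F : ℕ → MeasurableSpace Ω) (hF : ∀ j, F j ≤ m0) (hmono : Monotone F)
    {X : Ω → ℝ} (Y : ℕ → Ω → ℝ) (hYm : ∀ j, StronglyMeasurable[F j] (Y j))
    (hYi : ∀ j, Integrable (Y j) μ) (a b v : ℕ → ℝ) (hab : ∀ j, a j ≤ b j)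
    (hv : ∀ j, (b j - a j) ^ 2 ≤ v j)
    (hrange : ∀ j, ∀ᵐ ω ∂μ, (μ[X | F (j + 1)]) ω - Y j ω ∈ Set.Icc (a j) (b j)) (l : ℝ) (q : ℕ) :
    Integrable (fun ω => Real.exp (l * ((μ[X | F q]) ω - (μ[X | F 0]) ω))) μ ∧
    ∫ ω, Real.exp (l * ((μ[X | F q]) ω - (μ[X | F 0]) ω)) ∂μ ≤
      Real.exp (l ^ 2 * (∑ j ∈ Finset.range q, v j) / 8) := by
  induction q with
  | zero => simp
  | succ q ih =>
    have hmq : F q ≤ F (q + 1) := hmono (Nat.le_succ q)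
    obtain ⟨h1, h2⟩ := integral_mul_exp_sub_condExp_le (μ := μ) (hF q)
      (X := fun ω => (μ[X | F (q + 1)]) ω - Y q ω) (Z := fun ω => (μ[X | F q]) ω - Y q ω)
      (W := fun ω => Real.exp (l * ((μ[X | F q]) ω - (μ[X | F 0]) ω))) (l := l)
      (hab q) (integrable_condExp.sub (hYi q)).aestronglyMeasurable (hrange q)
      (by
        have e1 := condExp_sub (m := F q) (μ := μ) (integrable_condExp (m := F (q + 1)) (f := X))
          (hYi q)
        have e2 := condExp_condExp_of_le (f := X) (μ := μ) hmq (hF (q + 1))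
        have e3 := condExp_of_stronglyMeasurable (hF q) (hYm q) (hYi q)
        filter_upwards [e1, e2] with ω e1 e2
        refine Eq.trans ?_ e1.symm
        simp only [Pi.sub_apply, e2, e3])
      (stronglyMeasurable_condExp.sub (hYm q))
      (Real.continuous_exp.comp_stronglyMeasurable ((stronglyMeasurable_condExp.sub
        (stronglyMeasurable_condExp.mono (hmono (Nat.zero_le q)))).const_mul l))
      (fun ω => Real.exp_nonneg _) ih.1
    have e : ∀ ω, Real.exp (l * ((μ[X | F q]) ω - (μ[X | F 0]) ω)) *
        Real.exp (l * ((μ[X | F (q + 1)]) ω - Y q ω - ((μ[X | F q]) ω - Y q ω))) =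
        Real.exp (l * ((μ[X | F (q + 1)]) ω - (μ[X | F 0]) ω)) := fun ω => by
      rw [← Real.exp_add]; ring_nf
    simp only [e] at h1 h2
    refine ⟨h1, h2.trans ?_⟩
    calc _ ≤ Real.exp (l ^ 2 * v q / 8) * Real.exp (l ^ 2 * (∑ j ∈ Finset.range q, v j) / 8) := by
          gcongr
          · exact hv q
          · exact ih.2
      _ = _ := by rw [← Real.exp_add, Finset.sum_range_succ]; ring_nf

end

section
variable {S : Type*} [MeasurableSpace S]

/-- The action of a kernel on real functions. -/
noncomputable def kernelAct (P : Kernel S S) (f : S → ℝ) : S → ℝ := fun x => ∫ y, f y ∂(P x)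

variable {P : Kernel S S} {f : S → ℝ}

theorem measurable_kernelAct (hf : Measurable f) : Measurable (kernelAct P f) :=
  (hf.stronglyMeasurable.integral_kernel).measurable

theorem measurable_iterate_kernelAct (hf : Measurable f) (k : ℕ) :
    Measurable ((kernelAct P)^[k] f) := by
  induction k with
  | zero => exact hf
  | succ k ih => rw [Function.iterate_succ_apply']; exact measurable_kernelAct ih

variable [IsMarkovKernel P]

theorem abs_kernelAct_le {c : ℝ} (hb : ∀ x, |f x| ≤ c) (x : S) :
    |kernelAct P f x| ≤ c := by
  simpa [kernelAct] using norm_integral_le_of_norm_le_const (μ := P x) (f := f)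
    (ae_of_all _ fun y => (Real.norm_eq_abs _).trans_le (hb y))

theorem abs_iterate_kernelAct_le {c : ℝ} (hb : ∀ x, |f x| ≤ c) (k : ℕ) :
    ∀ x, |(kernelAct P)^[k] f x| ≤ c := by
  induction k with
  | zero => exact hb
  | succ k ih => rw [Function.iterate_succ_apply']; exact abs_kernelAct_le ih

theorem isProbabilityMeasure_iterPush (ν : Measure S) [IsProbabilityMeasure ν] (k : ℕ) :
    IsProbabilityMeasure (iterPush P k ν) := by
  induction k with
  | zero => assumption
  | succ k ih =>
    have : IsProbabilityMeasure ((iterPush P k ν).bind P) := inferInstance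
    exact this

theorem integral_bind_eq_integral_kernelAct (ν : Measure S) [IsFiniteMeasure ν]
    (hf : Measurable f) {c : ℝ} (hb : ∀ x, |f x| ≤ c) :
    ∫ x, f x ∂(ν.bind P) = ∫ x, kernelAct P f x ∂ν :=
  Kernel.integral_comp (κ := Kernel.const Unit ν) (η := P) (a := ())
    (Integrable.of_bound hf.aestronglyMeasurable c (ae_of_all _ hb))

theorem integral_iterPush (ν : Measure S) [IsProbabilityMeasure ν] {c : ℝ} (k : ℕ) (f : S → ℝ)
    (hf : Measurable f) (hb : ∀ x, |f x| ≤ c) :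
    ∫ x, f x ∂(iterPush P k ν) = ∫ x, (kernelAct P)^[k] f x ∂ν := by
  induction k generalizing f with
  | zero => rfl
  | succ k ih =>
    have := isProbabilityMeasure_iterPush (P := P) ν k
    rw [Function.iterate_succ_apply, ← ih _ (measurable_kernelAct hf) (abs_kernelAct_le hb)]
    exact integral_bind_eq_integral_kernelAct _ hf hb

theorem abs_iterate_kernelAct_sub_integral_le {π : Measure S} [IsProbabilityMeasure π]
    {Cmix β : ℝ} (herg : ∀ ν : Measure S, IsProbabilityMeasure ν → ∀ t : ℕ,
        tvDist (iterPush P t ν) π ≤ Cmix * β ^ t)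
    (hf : Measurable f) (hb : ∀ x, |f x| ≤ 1) (k : ℕ) (x : S) :
    |(kernelAct P)^[k] f x - ∫ y, f y ∂π| ≤ 2 * Cmix * β ^ k := by
  have hp := isProbabilityMeasure_iterPush (P := P) (Measure.dirac x) k
  have h1 := abs_integral_sub_le_two_mul_tvDist (iterPush P k (Measure.dirac x)) π hf hb
  rw [integral_iterPush _ k f hf hb, integral_dirac' _ _
    (measurable_iterate_kernelAct hf k).stronglyMeasurable] at h1
  have := herg (Measure.dirac x) inferInstance k
  linarith

section Hist

variable {Ω : Type*} {A : ℕ → Ω → S}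

theorem histSigmaA_mono : Monotone (histSigmaA A) := fun _ _ h =>
  biSup_mono fun _ hs => Finset.Icc_subset_Icc_right h hs

theorem histSigmaA_zero : histSigmaA A 0 = ⊥ := by simp [histSigmaA]

theorem measurable_histSigmaA {s t : ℕ} (h1 : 1 ≤ s) (h2 : s ≤ t) :
    Measurable[histSigmaA A t] (A s) := by
  refine measurable_iff_comap_le.2 ?_
  exact le_iSup₂_of_le (f := fun s (_ : s ∈ Finset.Icc 1 t) =>
    MeasurableSpace.comap (A s) inferInstance) s (Finset.mem_Icc.2 ⟨h1, h2⟩) le_rfl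

end Hist

variable {Ω : Type*} [mΩ : MeasurableSpace Ω] {μ : Measure Ω} [IsProbabilityMeasure μ]
  {A : ℕ → Ω → S}

theorem histSigmaA_le (hA : ∀ t, Measurable (A t)) (t : ℕ) : histSigmaA A t ≤ mΩ :=
  iSup₂_le fun s _ => (hA s).comap_le

theorem integrable_comp_of_abs_le {c : ℝ} (hA : ∀ t, Measurable (A t)) (hf : Measurable f)
    (hb : ∀ x, |f x| ≤ c) (t : ℕ) : Integrable (fun ω => f (A t ω)) μ :=
  Integrable.of_bound (hf.comp (hA t)).aestronglyMeasurable c (ae_of_all _ fun _ => hb _)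

theorem condExp_next (hA : ∀ t, Measurable (A t))
    (hMarkov : ∀ t : ℕ, 1 ≤ t → ∀ B : Set S, MeasurableSet B →
      μ[fun ω => Set.indicator B (fun _ => (1 : ℝ)) (A (t + 1) ω) | histSigmaA A t]
        =ᵐ[μ] fun ω => ((P (A t ω)) B).toReal)
    {t : ℕ} (ht : 1 ≤ t) (hf : Measurable f) {c : ℝ} (hb : ∀ x, |f x| ≤ c) :
    (fun ω => kernelAct P f (A t ω)) =ᵐ[μ] μ[fun ω => f (A (t + 1) ω) | histSigmaA A t] := by
  have hPm : Measurable (kernelAct P f) := measurable_kernelAct hf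
  refine ae_eq_condExp_of_forall_setIntegral_eq (histSigmaA_le hA t)
    (integrable_comp_of_abs_le hA hf hb _)
    (fun s _ _ => (integrable_comp_of_abs_le hA hPm (abs_kernelAct_le hb) _).integrableOn)
    (fun s hs _ => ?_)
    (hPm.comp (measurable_histSigmaA ht le_rfl)).stronglyMeasurable.aestronglyMeasurable
  have hs' : MeasurableSet s := histSigmaA_le hA t s hs
  have hlaw : (μ.restrict s).map (A (t + 1)) = ((μ.restrict s).map (A t)).bind P := by
    ext B hB
    have hind : Measurable (Set.indicator B (fun _ => (1 : ℝ))) := measurable_const.indicator hB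
    have h1 : ∫ ω in s, Set.indicator B (fun _ => (1 : ℝ)) (A (t + 1) ω) ∂μ =
        ∫ ω in s, ((P (A t ω)) B).toReal ∂μ := by
      rw [← setIntegral_condExp (histSigmaA_le hA t)
        (integrable_comp_of_abs_le (c := 1) hA hind
          (fun x => by by_cases h : x ∈ B <;> simp [h]) _) hs]
      exact integral_congr_ae (ae_restrict_of_ae (hMarkov t ht B hB))
    rw [Measure.bind_apply hB P.aemeasurable, lintegral_map (P.measurable_coe hB) (hA t),
      Measure.map_apply (hA _) hB]
    have h2 : ∫ ω in s, Set.indicator B (fun _ => (1 : ℝ)) (A (t + 1) ω) ∂μ =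
        ((μ.restrict s) (A (t + 1) ⁻¹' B)).toReal := by
      have := integral_indicator_one (μ := μ.restrict s) (hA (t + 1) hB)
      rw [Measure.real] at this
      rw [← this]; rfl
    have h3 : ∫ ω in s, ((P (A t ω)) B).toReal ∂μ =
        (∫⁻ ω in s, (P (A t ω)) B ∂μ).toReal :=
      integral_toReal ((P.measurable_coe hB).comp (hA t)).aemeasurable
        (ae_of_all _ fun ω => measure_lt_top _ _)
    rw [h2, h3] at h1
    refine (ENNReal.toReal_eq_toReal_iff' (measure_ne_top _ _) ?_).1 h1
    refine ne_of_lt (lt_of_le_of_lt (lintegral_mono fun ω => prob_le_one) ?_)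
    simp
  calc ∫ ω in s, kernelAct P f (A t ω) ∂μ
      = ∫ x, kernelAct P f x ∂((μ.restrict s).map (A t)) :=
        (integral_map (hA t).aemeasurable hPm.aestronglyMeasurable).symm
    _ = ∫ x, f x ∂((μ.restrict s).map (A (t + 1))) := by
        rw [hlaw]
        have := Measure.isFiniteMeasure_map (μ.restrict s) (A t)
        rw [integral_bind_eq_integral_kernelAct _ hf hb]
    _ = _ := integral_map (hA _).aemeasurable hf.aestronglyMeasurable

theorem condExp_iterate (hA : ∀ t, Measurable (A t))
    (hMarkov : ∀ t : ℕ, 1 ≤ t → ∀ B : Set S, MeasurableSet B →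
      μ[fun ω => Set.indicator B (fun _ => (1 : ℝ)) (A (t + 1) ω) | histSigmaA A t]
        =ᵐ[μ] fun ω => ((P (A t ω)) B).toReal)
    (hf : Measurable f) {c : ℝ} (hb : ∀ x, |f x| ≤ c) (k : ℕ) {t : ℕ} (ht : 1 ≤ t) :
    μ[fun ω => f (A (t + k) ω) | histSigmaA A t] =ᵐ[μ]
      fun ω => (kernelAct P)^[k] f (A t ω) := by
  induction k generalizing t with
  | zero =>
    exact (condExp_of_stronglyMeasurable (f := fun ω => f (A t ω)) (histSigmaA_le hA t)
      (hf.comp (measurable_histSigmaA ht le_rfl)).stronglyMeasurable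
      (integrable_comp_of_abs_le hA hf hb t)).eventuallyEq
  | succ k ih =>
    have h1 := condExp_condExp_of_le (f := fun ω => f (A (t + (k + 1)) ω)) (μ := μ)
      (histSigmaA_mono (A := A) (Nat.le_succ t)) (histSigmaA_le hA (t + 1))
    have h2 := ih (t := t + 1) (by omega)
    rw [show t + 1 + k = t + (k + 1) by omega] at h2
    have h3 := condExp_next hA hMarkov ht (measurable_iterate_kernelAct (P := P) hf k)
      (abs_iterate_kernelAct_le hb k)
    rw [Function.iterate_succ_apply']
    exact h1.symm.trans ((condExp_congr_ae h2).trans h3.symm)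

theorem condExp_sum (hA : ∀ t, Measurable (A t))
    (hMarkov : ∀ t : ℕ, 1 ≤ t → ∀ B : Set S, MeasurableSet B →
      μ[fun ω => Set.indicator B (fun _ => (1 : ℝ)) (A (t + 1) ω) | histSigmaA A t]
        =ᵐ[μ] fun ω => ((P (A t ω)) B).toReal)
    (hf : Measurable f) {c : ℝ} (hb : ∀ x, |f x| ≤ c) {t : ℕ} (ht : 1 ≤ t) (k : ℕ) :
    μ[fun ω => ∑ s ∈ Finset.Icc 1 (t + k), f (A s ω) | histSigmaA A t] =ᵐ[μ]
      fun ω => ∑ s ∈ Finset.Icc 1 t, f (A s ω) +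
        ∑ j ∈ Finset.range k, (kernelAct P)^[j + 1] f (A t ω) := by
  induction k with
  | zero =>
    rw [condExp_of_stronglyMeasurable (histSigmaA_le hA t)]
    · simp
    · refine Finset.stronglyMeasurable_fun_sum _ fun s hs => ?_
      rw [Finset.mem_Icc] at hs
      exact (hf.comp (measurable_histSigmaA hs.1 hs.2)).stronglyMeasurable
    · exact integrable_finsetSum _ fun s _ => integrable_comp_of_abs_le hA hf hb s
  | succ k ih =>
    have h1 := condExp_add (m := histSigmaA A t) (μ := μ)
      (f := fun ω => ∑ s ∈ Finset.Icc 1 (t + k), f (A s ω))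
      (g := fun ω => f (A (t + (k + 1)) ω))
      (integrable_finsetSum _ fun s _ => integrable_comp_of_abs_le hA hf hb s)
      (integrable_comp_of_abs_le hA hf hb _)
    have e : (fun ω => ∑ s ∈ Finset.Icc 1 (t + (k + 1)), f (A s ω)) =
        (fun ω => ∑ s ∈ Finset.Icc 1 (t + k), f (A s ω)) + fun ω => f (A (t + (k + 1)) ω) := by
      funext ω
      rw [← add_assoc, Finset.sum_Icc_succ_top (by omega)]; rfl
    rw [e]
    filter_upwards [h1, ih, condExp_iterate hA hMarkov hf hb (k + 1) ht] with ω h1 h2 h3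
    rw [h1, Pi.add_apply, h2, h3, Finset.sum_range_succ, add_assoc]

end

theorem sum_min_one_mul_pow_le {β : ℝ} (hβ0 : 0 < β) (hβ1 : β < 1) (N : ℕ) {c : ℝ} (hc : 0 < c) :
    ∑ k ∈ Finset.range N, min 1 (c * β ^ k) ≤
      (if 1 ≤ c then Real.log c + 1 else c) / (1 - β) := by
  have hd : 0 < 1 - β := sub_pos.2 hβ1
  induction N generalizing c with
  | zero =>
    simp only [Finset.range_zero, Finset.sum_empty]
    split_ifs with h
    · have := Real.log_nonneg h; positivity
    · positivity
  | succ N ih =>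
    rw [Finset.sum_range_succ']
    have h := ih (c := c * β) (by positivity)
    have e : ∀ k, c * β * β ^ k = c * β ^ (k + 1) := fun k => by ring
    simp only [e] at h
    simp only [pow_zero, mul_one]
    rw [le_div_iff₀ hd] at h ⊢
    by_cases h1 : 1 ≤ c
    · rw [if_pos h1, min_eq_left h1]
      by_cases h2 : 1 ≤ c * β
      · rw [if_pos h2, Real.log_mul hc.ne' hβ0.ne'] at h
        have := Real.log_le_sub_one_of_pos hβ0
        linarith
      · rw [if_neg h2] at h
        push Not at h2
        have h3 := Real.one_sub_inv_le_log_of_pos hc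
        have h4 : β ≤ c⁻¹ := by rw [← one_div, le_div_iff₀ hc]; linarith
        have h5 : β * (c - 1) ≤ c⁻¹ * (c - 1) := by
          apply mul_le_mul_of_nonneg_right h4; linarith
        have h6 : c⁻¹ * (c - 1) = 1 - c⁻¹ := by field_simp
        linarith
    · push Not at h1
      have h2 : ¬ 1 ≤ c * β := by push Not; nlinarith
      rw [if_neg h2] at h
      rw [if_neg (not_le.2 h1), min_eq_right h1.le]
      linarith

theorem exists_forall_mem_Icc_of_sub_le {S : Type*} [Nonempty S] {G : S → ℝ} {w : ℝ}
    (h : ∀ x y, G x - G y ≤ w) : ∃ g, ∀ x, G x ∈ Set.Icc g (g + w) := by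
  obtain ⟨x0⟩ := ‹Nonempty S›
  have hbdd : BddBelow (Set.range G) := ⟨G x0 - w, by
    rintro _ ⟨y, rfl⟩; linarith [h x0 y]⟩
  refine ⟨⨅ x, G x, fun x => ⟨ciInf_le hbdd x, ?_⟩⟩
  have := le_ciInf (f := G) (c := G x - w) fun y => by linarith [h x y]
  linarith

section
variable {S : Type*} [MeasurableSpace S] {P : Kernel S S} [IsMarkovKernel P] {f : S → ℝ}
  {Ω : Type*} [mΩ : MeasurableSpace Ω] {μ : Measure Ω} [IsProbabilityMeasure μ]
  {A : ℕ → Ω → S} {π : Measure S} [IsProbabilityMeasure π] {Cmix β : ℝ}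

theorem sum_iterate_kernelAct_sub_le (hC : 1 / 2 ≤ Cmix) (hβ0 : 0 < β) (hβ1 : β < 1)
    (herg : ∀ ν : Measure S, IsProbabilityMeasure ν → ∀ t : ℕ,
        tvDist (iterPush P t ν) π ≤ Cmix * β ^ t)
    (hf : Measurable f) (hb : ∀ x, |f x| ≤ 1) (m : ℕ) (x y : S) :
    ∑ k ∈ Finset.range m, (kernelAct P)^[k + 1] f x -
      ∑ k ∈ Finset.range m, (kernelAct P)^[k + 1] f y ≤
        2 * ((Real.log (2 * Cmix) + 1) / (1 - β) - 1) := by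
  have h1 := sum_min_one_mul_pow_le hβ0 hβ1 (m + 1) (c := 2 * Cmix) (by linarith)
  rw [if_pos (by linarith), Finset.sum_range_succ', pow_zero, mul_one,
    min_eq_left (by linarith)] at h1
  rw [← Finset.sum_sub_distrib]
  calc _ ≤ ∑ k ∈ Finset.range m, 2 * min 1 (2 * Cmix * β ^ (k + 1)) := by
        refine Finset.sum_le_sum fun k _ => ?_
        rw [mul_min_of_nonneg _ _ zero_le_two]
        refine le_min ?_ ?_
        · have e1 := (abs_le.1 (abs_iterate_kernelAct_le (P := P) hb (k + 1) x)).2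
          have e2 := (abs_le.1 (abs_iterate_kernelAct_le (P := P) hb (k + 1) y)).1
          linarith
        · have e1 := (abs_le.1 (abs_iterate_kernelAct_sub_integral_le herg hf hb (k + 1) x)).2
          have e2 := (abs_le.1 (abs_iterate_kernelAct_sub_integral_le herg hf hb (k + 1) y)).1
          linarith
    _ ≤ _ := by rw [← Finset.mul_sum]; linarith

theorem hasSubgaussianMGF_sum_chain (hA : ∀ t, Measurable (A t))
    (hMarkov : ∀ t : ℕ, 1 ≤ t → ∀ B : Set S, MeasurableSet B →
      μ[fun ω => Set.indicator B (fun _ => (1 : ℝ)) (A (t + 1) ω) | histSigmaA A t]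
        =ᵐ[μ] fun ω => ((P (A t ω)) B).toReal)
    (hC : 1 / 2 ≤ Cmix) (hβ0 : 0 < β) (hβ1 : β < 1)
    (herg : ∀ ν : Measure S, IsProbabilityMeasure ν → ∀ t : ℕ,
        tvDist (iterPush P t ν) π ≤ Cmix * β ^ t)
    (hf : Measurable f) (hb : ∀ x, |f x| ≤ 1) {n : ℕ} (hn : 1 ≤ n) :
    HasSubgaussianMGF (fun ω => ∑ t ∈ Finset.Icc 1 n, f (A t ω) -
        ∫ ω', ∑ t ∈ Finset.Icc 1 n, f (A t ω') ∂μ)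
      (Real.toNNReal (4 * n * ((Real.log (2 * Cmix) + 1) / (1 - β)))) μ := by
  set V := (Real.log (2 * Cmix) + 1) / (1 - β) with hVdef
  have hV1 : 1 ≤ V := by
    have := Real.log_nonneg (x := 2 * Cmix) (by linarith)
    rw [hVdef, le_div_iff₀ (by linarith)]
    linarith
  obtain ⟨τ, hτ⟩ : ∃ τ : ℕ, τ = ⌊V⌋₊ := ⟨_, rfl⟩
  have hτ1 : 1 ≤ τ := hτ ▸ Nat.le_floor (by simpa using hV1)
  have hτV : (τ : ℝ) ≤ V := hτ ▸ Nat.floor_le (by linarith)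
  have hVτ : V - 1 ≤ τ := by have := Nat.lt_floor_add_one V; rw [← hτ] at this; linarith
  have hτ0 : (0 : ℝ) ≤ τ := τ.cast_nonneg
  obtain ⟨N, hN⟩ : ∃ N : ℕ → ℕ, ∀ j, N j = min (j * τ) n := ⟨_, fun _ => rfl⟩
  have hNmono : Monotone N := fun i j hij => by
    rw [hN, hN]; exact min_le_min_right _ (Nat.mul_le_mul_right _ hij)
  have hNn : ∀ j, N j ≤ n := fun j => by rw [hN]; exact min_le_right _ _
  have hN0 : N 0 = 0 := by simp [hN]
  have hNlast : N n = n := by rw [hN]; exact min_eq_right (Nat.le_mul_of_pos_right _ hτ1)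
  have hNpos : ∀ j, 1 ≤ N (j + 1) := fun j => by
    rw [hN]; exact le_min (Nat.mul_pos (Nat.succ_pos _) hτ1) hn
  set X : Ω → ℝ := fun ω => ∑ t ∈ Finset.Icc 1 n, f (A t ω) with hX
  obtain ⟨w, hw⟩ : ∃ w : ℕ → ℝ, ∀ m, w m = if m = 0 then 0 else 2 * (V - 1) := ⟨_, fun _ => rfl⟩
  have hne : Nonempty S := ⟨A 0 (nonempty_of_isProbabilityMeasure μ).some⟩
  have hG : ∀ m, ∃ g, ∀ x, ∑ k ∈ Finset.range m, (kernelAct P)^[k + 1] f x ∈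
      Set.Icc g (g + w m) := fun m => by
    refine exists_forall_mem_Icc_of_sub_le fun x y => ?_
    rw [hw]
    split_ifs with h
    · simp [h]
    · exact sum_iterate_kernelAct_sub_le hC hβ0 hβ1 herg hf hb m x y
  choose g hg using hG
  have hw0 : ∀ m, 0 ≤ w m := fun m => by rw [hw]; split_ifs <;> linarith
  obtain ⟨l, hl⟩ : ∃ l : ℕ → ℝ, ∀ j, l j = (N (j + 1) : ℝ) - N j := ⟨_, fun _ => rfl⟩
  have hl0 : ∀ j, 0 ≤ l j := fun j => by
    rw [hl]; exact sub_nonneg.2 (Nat.cast_le.2 (hNmono (Nat.le_succ j)))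
  have hlτ : ∀ j, l j ≤ τ := fun j => by
    have : N (j + 1) ≤ N j + τ := by
      rw [hN, hN, Nat.succ_mul]; omega
    rw [hl, sub_le_iff_le_add']; exact_mod_cast this
  have hlsum : ∑ j ∈ Finset.range n, 16 * V * l j = 16 * V * n := by
    rw [← Finset.mul_sum]
    simp only [hl]
    rw [Finset.sum_range_sub (fun j => (N j : ℝ)), hN0, hNlast]; simp
  have hint : ∀ k, Integrable (fun ω => ∑ t ∈ Finset.Icc 1 k, f (A t ω)) μ := fun k =>
    integrable_finsetSum _ fun s _ => integrable_comp_of_abs_le hA hf hb s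
  have hmeas : ∀ k, StronglyMeasurable[histSigmaA A k]
      (fun ω => ∑ t ∈ Finset.Icc 1 k, f (A t ω)) := fun k =>
    Finset.stronglyMeasurable_fun_sum _ fun s hs =>
      (hf.comp (measurable_histSigmaA (Finset.mem_Icc.1 hs).1
        (Finset.mem_Icc.1 hs).2)).stronglyMeasurable
  have main := doob_integral_exp_le (μ := μ) (fun j => histSigmaA A (N j))
    (fun j => histSigmaA_le hA _) (fun i j h => histSigmaA_mono (hNmono h)) (X := X)
    (fun j ω => ∑ t ∈ Finset.Icc 1 (N j), f (A t ω)) (fun j => hmeas _) (fun j => hint _)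
    (fun j => -l j + g (n - N (j + 1)))
    (fun j => l j + (g (n - N (j + 1)) + w (n - N (j + 1)))) (fun j => 16 * V * l j)
    (fun j => by linarith [hl0 j, hw0 (n - N (j + 1))])
    (fun j => by
      have e : l j + (g (n - N (j + 1)) + w (n - N (j + 1))) - (-l j + g (n - N (j + 1))) =
        2 * l j + w (n - N (j + 1)) := by ring
      rw [e]
      by_cases hj : (j + 1) * τ < n
      · have hlj : l j = τ := by
          rw [hl, hN, hN, min_eq_left hj.le, min_eq_left (by rw [Nat.succ_mul] at hj; omega)]
          push_cast; ring
        have hwj : w (n - N (j + 1)) ≤ 2 * τ := by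
          rw [hw]; split_ifs <;> linarith
        calc _ ≤ (4 * (τ : ℝ)) ^ 2 := by
              apply pow_le_pow_left₀ (by linarith [hl0 j, hw0 (n - N (j + 1))]); linarith
          _ ≤ 16 * V * l j := by rw [hlj]; nlinarith
      · have hNj : N (j + 1) = n := by rw [hN]; exact min_eq_right (not_lt.1 hj)
        have : w (n - N (j + 1)) = 0 := by rw [hw, hNj]; simp
        rw [this]
        nlinarith [hlτ j, hl0 j, mul_le_mul_of_nonneg_right ((hlτ j).trans hτV) (hl0 j)])
    (fun j => by
      have h := condExp_sum (μ := μ) hA hMarkov hf hb (hNpos j) (n - N (j + 1))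
      rw [Nat.add_sub_cancel' (hNn _)] at h
      filter_upwards [h] with ω h
      rw [h]
      have hs : ∑ t ∈ Finset.Icc 1 (N (j + 1)), f (A t ω) =
          ∑ t ∈ Finset.Icc 1 (N j), f (A t ω) + ∑ t ∈ Finset.Ioc (N j) (N (j + 1)), f (A t ω) := by
        have hI : ∀ k, Finset.Icc 1 k = Finset.Ioc 0 k := fun k => by
          ext; simp [Finset.mem_Icc, Finset.mem_Ioc, Nat.succ_le_iff]
        rw [hI, hI, Finset.sum_Ioc_consecutive _ (Nat.zero_le _) (hNmono (Nat.le_succ j))]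
      have hsb : |∑ t ∈ Finset.Ioc (N j) (N (j + 1)), f (A t ω)| ≤ l j := by
        refine (Finset.abs_sum_le_sum_abs _ _).trans ?_
        refine (Finset.sum_le_card_nsmul _ _ 1 fun t _ => hb _).trans_eq ?_
        rw [Nat.card_Ioc, hl, nsmul_eq_mul, mul_one, Nat.cast_sub (hNmono (Nat.le_succ j))]
      have h1 := hg (n - N (j + 1)) (A (N (j + 1)) ω)
      have h2 := abs_le.1 hsb
      rw [hs]
      exact ⟨by linarith [h1.1], by linarith [h1.2]⟩)
  have hlast : μ[X | histSigmaA A (N n)] = X := by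
    rw [hNlast]; exact condExp_of_stronglyMeasurable (histSigmaA_le hA n) (hmeas n) (hint n)
  have hfirst : μ[X | histSigmaA A (N 0)] = fun _ => ∫ ω, X ω ∂μ := by
    rw [hN0, histSigmaA_zero]; exact condExp_bot X
  refine ⟨fun t => ?_, fun t => ?_⟩
  · have := (main t n).1
    rwa [hlast, hfirst] at this
  · have := (main t n).2
    rw [hlast, hfirst, hlsum] at this
    refine this.trans_eq ?_
    rw [Real.coe_toNNReal _ (by positivity)]
    congr 1; ring

theorem abs_integral_sum_chain_sub_le (hA : ∀ t, Measurable (A t))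
    (hMarkov : ∀ t : ℕ, 1 ≤ t → ∀ B : Set S, MeasurableSet B →
      μ[fun ω => Set.indicator B (fun _ => (1 : ℝ)) (A (t + 1) ω) | histSigmaA A t]
        =ᵐ[μ] fun ω => ((P (A t ω)) B).toReal)
    (hC : 0 ≤ Cmix) (hβ0 : 0 < β) (hβ1 : β < 1)
    (herg : ∀ ν : Measure S, IsProbabilityMeasure ν → ∀ t : ℕ,
        tvDist (iterPush P t ν) π ≤ Cmix * β ^ t)
    (hf : Measurable f) (hb : ∀ x, |f x| ≤ 1) (n : ℕ) :
    |∫ ω, ∑ t ∈ Finset.Icc 1 n, f (A t ω) ∂μ - n * ∫ x, f x ∂π| ≤ 2 * Cmix / (1 - β) := by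
  have h1 : ∀ k, |∫ ω, f (A (1 + k) ω) ∂μ - ∫ x, f x ∂π| ≤ 2 * Cmix * β ^ k := fun k => by
    rw [← integral_condExp (histSigmaA_le hA 1),
      integral_congr_ae (condExp_iterate hA hMarkov hf hb k le_rfl)]
    have hi := integrable_comp_of_abs_le (μ := μ) hA (measurable_iterate_kernelAct (P := P) hf k)
      (abs_iterate_kernelAct_le hb k) 1
    have e : ∫ ω, (kernelAct P)^[k] f (A 1 ω) ∂μ - ∫ x, f x ∂π =
        ∫ ω, ((kernelAct P)^[k] f (A 1 ω) - ∫ x, f x ∂π) ∂μ := by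
      rw [integral_sub hi (integrable_const _)]; simp
    rw [e]
    simpa using norm_integral_le_of_norm_le_const (μ := μ)
      (f := fun ω => (kernelAct P)^[k] f (A 1 ω) - ∫ x, f x ∂π)
      (ae_of_all _ fun ω => (Real.norm_eq_abs _).trans_le
        (abs_iterate_kernelAct_sub_integral_le herg hf hb k (A 1 ω)))
  rw [integral_finsetSum _ fun s _ => integrable_comp_of_abs_le hA hf hb s,
    ← Finset.Ico_add_one_right_eq_Icc, Finset.sum_Ico_eq_sum_range, Nat.add_sub_cancel]
  have e : (n : ℝ) * ∫ x, f x ∂π = ∑ k ∈ Finset.range n, ∫ x, f x ∂π := by simp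
  rw [e, ← Finset.sum_sub_distrib]
  refine (Finset.abs_sum_le_sum_abs _ _).trans ((Finset.sum_le_sum fun k _ => h1 k).trans ?_)
  rw [← Finset.mul_sum, div_eq_mul_inv]
  gcongr
  rw [← tsum_geometric_of_lt_one hβ0.le hβ1]
  exact (summable_geometric_of_lt_one hβ0.le hβ1).sum_le_tsum _ fun _ _ => by positivity

theorem measureReal_chain_deviation_le (hA : ∀ t, Measurable (A t))
    (hMarkov : ∀ t : ℕ, 1 ≤ t → ∀ B : Set S, MeasurableSet B →
      μ[fun ω => Set.indicator B (fun _ => (1 : ℝ)) (A (t + 1) ω) | histSigmaA A t]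
        =ᵐ[μ] fun ω => ((P (A t ω)) B).toReal)
    (hC : 1 / 2 ≤ Cmix) (hβ0 : 0 < β) (hβ1 : β < 1)
    (herg : ∀ ν : Measure S, IsProbabilityMeasure ν → ∀ t : ℕ,
        tvDist (iterPush P t ν) π ≤ Cmix * β ^ t)
    (hf : Measurable f) (hb : ∀ x, |f x| ≤ 1) {n : ℕ} (hn : 1 ≤ n) {L : ℝ} (hL : 0 ≤ L) :
    μ.real {ω | Real.sqrt (36 * Real.log (4 * Cmix) * L / ((1 - β) * n)) +
        2 * Cmix / ((1 - β) * n) <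
          |∫ x, f x ∂π - (n : ℝ)⁻¹ * ∑ t ∈ Finset.Icc 1 n, f (A t ω)|} ≤
      2 * Real.exp (-(2 * L)) := by
  have hn0 : (0 : ℝ) < n := by exact_mod_cast hn
  have hd : 0 < 1 - β := sub_pos.2 hβ1
  have hlog : Real.log (4 * Cmix) = Real.log 2 + Real.log (2 * Cmix) := by
    rw [← Real.log_mul (by norm_num) (by linarith)]; ring_nf
  have hl2 : 0 ≤ Real.log (2 * Cmix) := Real.log_nonneg (by linarith)
  have hlog2 := Real.log_two_gt_d9
  set ε := Real.sqrt (36 * Real.log (4 * Cmix) * L / ((1 - β) * n)) with hε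
  set X : Ω → ℝ := fun ω => ∑ t ∈ Finset.Icc 1 n, f (A t ω)
  have hsub := hasSubgaussianMGF_sum_chain (μ := μ) hA hMarkov hC hβ0 hβ1 herg hf hb hn
  have hbias := abs_integral_sum_chain_sub_le (μ := μ) hA hMarkov (by linarith) hβ0 hβ1 herg hf hb n
  set E := ∫ ω, X ω ∂μ
  set c := Real.toNNReal (4 * n * ((Real.log (2 * Cmix) + 1) / (1 - β))) with hc
  have hcc : (c : ℝ) = 4 * n * ((Real.log (2 * Cmix) + 1) / (1 - β)) :=
    Real.coe_toNNReal _ (by positivity)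
  have hs0 : 0 ≤ n * ε := by positivity
  have hexp : Real.exp (-(n * ε) ^ 2 / (2 * c)) ≤ Real.exp (-(2 * L)) := by
    rw [Real.exp_le_exp, neg_div, neg_le_neg_iff, hcc, le_div_iff₀ (by positivity), mul_pow, hε,
      Real.sq_sqrt (by rw [hlog]; positivity)]
    have e1 : (n : ℝ) ^ 2 * (36 * Real.log (4 * Cmix) * L / ((1 - β) * n)) =
        n * L / (1 - β) * (36 * Real.log (4 * Cmix)) := by field_simp
    have e2 : 2 * L * (2 * (4 * n * ((Real.log (2 * Cmix) + 1) / (1 - β)))) =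
        n * L / (1 - β) * (16 * (Real.log (2 * Cmix) + 1)) := by field_simp; ring
    rw [e1, e2, hlog]
    refine mul_le_mul_of_nonneg_left ?_ (by positivity)
    linarith
  have t1 := (hsub.measure_ge_le hs0).trans hexp
  have t2 := (hsub.neg.measure_ge_le hs0).trans hexp
  calc _ ≤ μ.real ({ω | n * ε ≤ X ω - E} ∪
        {ω | n * ε ≤ (-fun ω => X ω - E) ω}) := by
        refine measureReal_mono fun ω hω => ?_
        simp only [Set.mem_ofPred_eq] at hω
        have hω' : n * ε + 2 * Cmix / (1 - β) < |n * ∫ x, f x ∂π - X ω| := by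
          have h1 := mul_lt_mul_of_pos_left hω hn0
          rw [← abs_of_pos hn0, ← abs_mul, abs_of_pos hn0] at h1
          have e1 : n * (ε + 2 * Cmix / ((1 - β) * n)) = n * ε + 2 * Cmix / (1 - β) := by
            field_simp
          rwa [e1, mul_sub, mul_inv_cancel_left₀ hn0.ne'] at h1
        have h2 : |n * ∫ x, f x ∂π - X ω| ≤ |X ω - E| + |E - n * ∫ x, f x ∂π| := by
          rw [abs_sub_comm]; exact abs_sub_le _ _ _
        have h3 : n * ε ≤ |X ω - E| := by linarith
        rcases le_abs.1 h3 with h | h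
        · exact Or.inl h
        · exact Or.inr h
    _ ≤ _ := (measureReal_union_le _ _).trans (by linarith)

end

theorem one_half_le_of_ergodic {S : Type*} [MeasurableSpace S] [MeasurableSingletonClass S]
    [Nontrivial S] {P : Kernel S S} {π : Measure S} [IsProbabilityMeasure π] {Cmix β : ℝ}
    (herg : ∀ ν : Measure S, IsProbabilityMeasure ν → ∀ t : ℕ,
        tvDist (iterPush P t ν) π ≤ Cmix * β ^ t) : 1 / 2 ≤ Cmix := by
  obtain ⟨x, y, hxy⟩ := exists_pair_ne S
  have h : ∀ z, |(Measure.dirac z).real {x} - π.real {x}| ≤ Cmix := fun z =>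
    (abs_measureReal_sub_le_tvDist _ _ (measurableSet_singleton x)).trans
      (by simpa [iterPush] using herg (Measure.dirac z) inferInstance 0)
  have h1 := (abs_le.1 (h x)).2
  have h2 := (abs_le.1 (h y)).1
  have e1 : (Measure.dirac x).real {x} = 1 := by simp [Measure.real]
  have e2 : (Measure.dirac y).real {x} = 0 := by simp [Measure.real, hxy.symm]
  rw [e1] at h1
  rw [e2] at h2
  linarith

theorem stmt_13 {S : Type u} {Ω : Type v} {d : ℕ}
    [MeasurableSpace S] [StandardBorelSpace S] [MeasurableSpace Ω]
    (μ : Measure Ω) [IsProbabilityMeasure μ]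
    -- the Markov kernel of the context chain
    (P : Kernel S S) [IsMarkovKernel P]
    -- the context process
    (A : ℕ → Ω → S) (hA : ∀ t, Measurable (A t))
    -- Markov property of the context chain with kernel `P`
    (hMarkov : ∀ t : ℕ, 1 ≤ t → ∀ B : Set S, MeasurableSet B →
      μ[fun ω => Set.indicator B (fun _ => (1 : ℝ)) (A (t + 1) ω) |
          histSigmaA A t]
        =ᵐ[μ] fun ω => ((P (A t ω)) B).toReal)
    -- stationary distribution, mixing constants
    (π : Measure S) [IsProbabilityMeasure π]
    (Cmix β : ℝ) (hC : 0 ≤ Cmix) (hβ0 : 0 < β) (hβ1 : β < 1)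
    (hstat : π.bind (fun x => P x) = π)
    -- uniform geometric ergodicity
    (herg : ∀ ν : Measure S, IsProbabilityMeasure ν → ∀ t : ℕ,
        tvDist (iterPush P t ν) π ≤ Cmix * β ^ t)
    -- compact context sets inside the unit ball
    (K : S → Set (EuclideanSpace ℝ (Fin d)))
    (hKne : ∀ x, (K x).Nonempty) (hKcp : ∀ x, IsCompact (K x))
    (hKb : ∀ x, ∀ a ∈ K x, ‖a‖ ≤ 1)
    -- parameter set inside the unit ball
    (Θ : Set (EuclideanSpace ℝ (Fin d))) (hΘb : ∀ θ ∈ Θ, ‖θ‖ ≤ 1)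
    -- measurable greedy selector
    (sel : EuclideanSpace ℝ (Fin d) → S → EuclideanSpace ℝ (Fin d))
    (hselm : ∀ θ ∈ Θ, Measurable (sel θ))
    (hselmem : ∀ θ ∈ Θ, ∀ x, sel θ x ∈ K x)
    (hselopt : ∀ θ ∈ Θ, ∀ x, ∀ a ∈ K x, ⟪a, θ⟫_ℝ ≤ ⟪sel θ x, θ⟫_ℝ)
    -- the stationary surrogate map g_π
    (g : EuclideanSpace ℝ (Fin d) → EuclideanSpace ℝ (Fin d))
    (hg : ∀ θ, g θ = ∫ x, sel θ x ∂π)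
    -- a finite (1/T)-net Θ' of Θ
    (T : ℝ) (hT : 0 < T)
    (Θ' : Finset (EuclideanSpace ℝ (Fin d))) (hsub : ↑Θ' ⊆ Θ)
    (hnet : ∀ θ ∈ Θ, ∃ φ ∈ Θ', ‖θ - φ‖ ≤ 1 / T)
    (M : ℕ) (hM : 1 ≤ M) (δ : ℝ) (hδ0 : 0 < δ) (hδ1 : δ < 1)
    (n : ℕ) (hn : 1 ≤ n) :
    (μ {ω | ∀ θ ∈ Θ', ∀ θ' ∈ Θ,
        |⟪g θ, θ'⟫_ℝ -
            ⟪(n : ℝ)⁻¹ • ∑ t ∈ Finset.Icc 1 n, sel θ (A t ω), θ'⟫_ℝ| ≤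
          Real.sqrt (36 * Real.log (4 * Cmix) *
              Real.log (2 * M * (Θ'.card : ℝ) / δ) / ((1 - β) * n)) +
            2 * Cmix / ((1 - β) * n) + 2 / T}).toReal
      ≥ 1 - δ / M := by
  have hd : 0 < 1 - β := sub_pos.2 hβ1
  have hn0 : (0 : ℝ) < n := by exact_mod_cast hn
  have hM0 : (1 : ℝ) ≤ M := by exact_mod_cast hM
  have hnorm : ∀ θ ∈ Θ, ∀ x, ‖sel θ x‖ ≤ 1 := fun θ hθ x => hKb x _ (hselmem θ hθ x)
  rcases subsingleton_or_nontrivial S with hS | hS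
  · have hall : {ω | ∀ θ ∈ Θ', ∀ θ' ∈ Θ,
        |⟪g θ, θ'⟫_ℝ - ⟪(n : ℝ)⁻¹ • ∑ t ∈ Finset.Icc 1 n, sel θ (A t ω), θ'⟫_ℝ| ≤
          Real.sqrt (36 * Real.log (4 * Cmix) * Real.log (2 * M * (Θ'.card : ℝ) / δ) /
            ((1 - β) * n)) + 2 * Cmix / ((1 - β) * n) + 2 / T} = Set.univ := by
      refine Set.eq_univ_of_forall fun ω θ _ θ' _ => ?_
      have e : ∀ x, sel θ x = sel θ (A 0 ω) := fun x => by rw [Subsingleton.elim x (A 0 ω)]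
      have e2 : (n : ℝ)⁻¹ • ∑ t ∈ Finset.Icc 1 n, sel θ (A t ω) = g θ := by
        rw [hg, Finset.sum_congr rfl fun t _ => e (A t ω), integral_congr_ae (ae_of_all _ e)]
        simp [← Nat.cast_smul_eq_nsmul ℝ, smul_smul, inv_mul_cancel₀ hn0.ne']
      rw [e2, sub_self, abs_zero]
      positivity
    rw [hall, measure_univ, ENNReal.toReal_one]
    have : 0 ≤ δ / M := by positivity
    linarith
  have hC2 : 1 / 2 ≤ Cmix := one_half_le_of_ergodic herg
  rcases Θ'.eq_empty_or_nonempty with rfl | hne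
  · have : 0 ≤ δ / M := by positivity
    simp [this]
  have hN : (1 : ℝ) ≤ Θ'.card := by exact_mod_cast hne.card_pos
  set N : ℝ := (Θ'.card : ℝ) with hNdef
  set L := Real.log (2 * M * N / δ) with hLdef
  have hMN : 1 ≤ M * N := one_le_mul_of_one_le_of_one_le hM0 hN
  have hL : 0 ≤ L := Real.log_nonneg (by rw [le_div_iff₀ hδ0]; nlinarith)
  set B : ℝ := Real.sqrt (36 * Real.log (4 * Cmix) * L / ((1 - β) * n)) +
    2 * Cmix / ((1 - β) * n) with hB
  set avg : EuclideanSpace ℝ (Fin d) → Ω → EuclideanSpace ℝ (Fin d) :=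
    fun θ ω => (n : ℝ)⁻¹ • ∑ t ∈ Finset.Icc 1 n, sel θ (A t ω) with havg
  have hpair : ∀ θ ∈ Θ', ∀ φ ∈ Θ',
      μ.real {ω | B < |⟪g θ, φ⟫_ℝ - ⟪avg θ ω, φ⟫_ℝ|} ≤ 2 * Real.exp (-(2 * L)) := by
    intro θ hθ φ hφ
    have hθm := hselm θ (hsub hθ)
    have hb : ∀ x, |⟪sel θ x, φ⟫_ℝ| ≤ 1 := fun x =>
      (abs_real_inner_le_norm _ _).trans
        (mul_le_one₀ (hnorm θ (hsub hθ) x) (norm_nonneg _) (hΘb φ (hsub hφ)))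
    have h := measureReal_chain_deviation_le (μ := μ) (f := fun x => ⟪sel θ x, φ⟫_ℝ) hA hMarkov
      hC2 hβ0 hβ1 herg (hθm.inner measurable_const) hb hn hL
    have hi : Integrable (sel θ) π := Integrable.of_bound hθm.aestronglyMeasurable 1
      (ae_of_all _ (hnorm θ (hsub hθ)))
    have e1 : ∫ x, ⟪sel θ x, φ⟫_ℝ ∂π = ⟪g θ, φ⟫_ℝ := by
      rw [hg, real_inner_comm, ← integral_inner hi]
      simp only [real_inner_comm]
    have e2 : ∀ ω, (n : ℝ)⁻¹ * ∑ t ∈ Finset.Icc 1 n, ⟪sel θ (A t ω), φ⟫_ℝ = ⟪avg θ ω, φ⟫_ℝ :=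
      fun ω => by rw [havg, real_inner_smul_left, sum_inner]
    simpa only [e1, e2] using h
  set bad : Set Ω := ⋃ p ∈ Θ' ×ˢ Θ', {ω | B < |⟪g p.1, p.2⟫_ℝ - ⟪avg p.1 ω, p.2⟫_ℝ|} with hbad
  have hexp : Real.exp (-(2 * L)) = (δ / (2 * M * N)) ^ 2 := by
    rw [← mul_neg, mul_comm, Real.exp_mul, Real.exp_neg, hLdef, Real.exp_log (by positivity),
      inv_div]
    norm_num
  have hbadle : μ.real bad ≤ δ / M := by
    calc μ.real bad ≤ ∑ p ∈ Θ' ×ˢ Θ', μ.real {ω | B < |⟪g p.1, p.2⟫_ℝ - ⟪avg p.1 ω, p.2⟫_ℝ|} :=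
          measureReal_biUnion_finset_le _ _
      _ ≤ ∑ p ∈ Θ' ×ˢ Θ', 2 * Real.exp (-(2 * L)) := by
          refine Finset.sum_le_sum fun p hp => ?_
          rw [Finset.mem_product] at hp
          exact hpair _ hp.1 _ hp.2
      _ = δ / M * (δ / (2 * M)) := by
          rw [Finset.sum_const, Finset.card_product, nsmul_eq_mul, Nat.cast_mul, ← hNdef, hexp]
          field_simp
      _ ≤ δ / M * 1 := by
          gcongr
          rw [div_le_one (by positivity)]
          linarith
      _ = δ / M := mul_one _
  have hcover : Set.univ ⊆ bad ∪ {ω | ∀ θ ∈ Θ', ∀ θ' ∈ Θ,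
      |⟪g θ, θ'⟫_ℝ - ⟪avg θ ω, θ'⟫_ℝ| ≤ B + 2 / T} := by
    intro ω _
    by_cases hω : ω ∈ bad
    · exact Or.inl hω
    refine Or.inr fun θ hθ θ' hθ' => ?_
    obtain ⟨φ, hφ, hdist⟩ := hnet θ' hθ'
    have h1 : |⟪g θ, φ⟫_ℝ - ⟪avg θ ω, φ⟫_ℝ| ≤ B := by
      by_contra! hlt
      exact hω (Set.mem_biUnion (x := (θ, φ)) (Finset.mem_product.2 ⟨hθ, hφ⟩) hlt)
    have hgn : ‖g θ‖ ≤ 1 := by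
      rw [hg]
      simpa using norm_integral_le_of_norm_le_const (μ := π) (ae_of_all _ (hnorm θ (hsub hθ)))
    have han : ‖avg θ ω‖ ≤ 1 := by
      rw [havg, norm_smul, norm_inv, Real.norm_natCast, inv_mul_le_iff₀ hn0, mul_one]
      refine (norm_sum_le _ _).trans
        ((Finset.sum_le_card_nsmul _ _ 1 fun t _ => hnorm θ (hsub hθ) _).trans_eq ?_)
      simp
    have h2 : |⟪g θ - avg θ ω, θ' - φ⟫_ℝ| ≤ 2 / T := by
      refine (abs_real_inner_le_norm _ _).trans ?_
      rw [show (2 : ℝ) / T = 2 * (1 / T) by ring]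
      have := (norm_sub_le (g θ) (avg θ ω)).trans (add_le_add hgn han)
      gcongr
      linarith
    have e : ⟪g θ, θ'⟫_ℝ - ⟪avg θ ω, θ'⟫_ℝ =
        (⟪g θ, φ⟫_ℝ - ⟪avg θ ω, φ⟫_ℝ) + ⟪g θ - avg θ ω, θ' - φ⟫_ℝ := by
      simp only [inner_sub_left, inner_sub_right]; ring
    rw [e]
    exact (abs_add_le _ _).trans (add_le_add h1 h2)
  have h1 := (measureReal_mono (μ := μ) hcover).trans (measureReal_union_le _ _)
  rw [probReal_univ] at h1
  change μ.real _ ≥ _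
  linarith
end

section
/- Let T ≥ 1, M ≥ 1 be integers and a, b ≥ 0 real numbers. For m ∈ {1,…,M} set H_m := 2^{m−1}, assume Σ_{m=1}^M H_m ≤ T, and let t^{(m)} be integers with t^{(m)} ≥ 2^{m−1} − 1 (so t^{(m)} ≥ H_m/2 for m ≥ 2). Define ε_1 := 1 and, for m ≥ 2, ε_m := √(a/t^{(m)}) + b/t^{(m)} + 2/T. Then Σ_{m=1}^M H_m·ε_m ≤ 3 + 4·√(2·a·T) + 2·b·M. -/
lemma mul_sqrt_div_le_of_le_two_mul {a h t : ℝ} (ha : 0 ≤ a) (hh : 0 ≤ h) (ht : 0 < t)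
    (hht : h ≤ 2 * t) : h * √(a / t) ≤ √(2 * a) * √h := by
  rw [← Real.sqrt_mul (by positivity)]
  apply Real.le_sqrt_of_sq_le
  rw [mul_pow, Real.sq_sqrt (by positivity), ← mul_div_assoc, div_le_iff₀ ht]
  nlinarith [mul_le_mul_of_nonneg_left hht (mul_nonneg ha hh)]

lemma four_mul_sqrt_add_sqrt_two_mul_le (x : ℝ) : 4 * √x + √(2 * x) ≤ 4 * √(2 * x) := by
  rw [Real.sqrt_mul zero_le_two]
  have h2 : (4 / 3 : ℝ) ≤ √2 := Real.le_sqrt_of_sq_le (by norm_num)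
  nlinarith [mul_le_mul_of_nonneg_right h2 (Real.sqrt_nonneg x)]

/-- The weighted sum over doubling epochs, with the constant part of the levels kept as a sum. -/
lemma sum_doubling_mul_le {a b c : ℝ} (ha : 0 ≤ a) (hb : 0 ≤ b) (hc : 0 ≤ c) (t : ℕ → ℕ)
    (ε : ℕ → ℝ) (hε1 : ε 1 = 1) (n : ℕ)
    (ht : ∀ m ∈ Finset.Icc 1 (n + 1), 2 ^ (m - 1) - 1 ≤ t m)
    (hε : ∀ m ∈ Finset.Icc 2 (n + 1), ε m = √(a / (t m : ℝ)) + b / (t m : ℝ) + c) :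
    ∑ m ∈ Finset.Icc 1 (n + 1), (2 : ℝ) ^ (m - 1) * ε m ≤
      1 + 4 * (√(2 * a) * √(2 ^ n)) + 2 * b * (n + 1)
        + c * ∑ m ∈ Finset.Icc 1 (n + 1), (2 : ℝ) ^ (m - 1) := by
  induction n with
  | zero =>
    simp only [zero_add, Finset.Icc_self, Finset.sum_singleton, hε1]
    have : 0 ≤ √(2 * a) * √(2 ^ 0) := by positivity
    simp only [Nat.sub_self, pow_zero, Nat.cast_zero] at this ⊢
    linarith
  | succ n ih =>
    have hsub (k : ℕ) : Finset.Icc k (n + 1) ⊆ Finset.Icc k (n + 1 + 1) :=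
      Finset.Icc_subset_Icc_right (Nat.le_succ _)
    have ih' := ih (fun m hm => ht m (hsub 1 hm)) (fun m hm => hε m (hsub 2 hm))
    have htn : 2 ^ (n + 1) - 1 ≤ t (n + 1 + 1) := ht (n + 1 + 1) (by simp)
    have hp : 1 ≤ 2 ^ n := Nat.one_le_two_pow
    have hpos : 0 < t (n + 1 + 1) := by rw [pow_succ] at htn; omega
    have hle : 2 ^ (n + 1) ≤ 2 * t (n + 1 + 1) := by omega
    have hposR : (0 : ℝ) < t (n + 1 + 1) := by exact_mod_cast hpos
    have hleR : (2 : ℝ) ^ (n + 1) ≤ 2 * t (n + 1 + 1) := by exact_mod_cast hle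
    simp only [Finset.sum_Icc_succ_top (show 1 ≤ n + 1 + 1 by omega)]
    rw [hε (n + 1 + 1) (by simp), Nat.add_sub_cancel]
    have hsqrt := mul_sqrt_div_le_of_le_two_mul ha (by positivity) hposR hleR
    have hbias : (2 : ℝ) ^ (n + 1) * (b / t (n + 1 + 1)) ≤ 2 * b := by
      rw [← mul_div_assoc, div_le_iff₀ hposR]
      nlinarith [mul_le_mul_of_nonneg_left hleR hb]
    have hstep := mul_le_mul_of_nonneg_left (four_mul_sqrt_add_sqrt_two_mul_le ((2 : ℝ) ^ n))
      (Real.sqrt_nonneg (2 * a))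
    rw [← pow_succ'] at hstep
    push_cast
    linarith

theorem stmt_14 (T M : ℕ) (hT : 1 ≤ T) (hM : 1 ≤ M)
    (a b : ℝ) (ha : 0 ≤ a) (hb : 0 ≤ b)
    (H : ℕ → ℕ) (hH : ∀ m, H m = 2 ^ (m - 1))
    (hHsum : (∑ m ∈ Finset.Icc 1 M, (H m : ℝ)) ≤ T)
    (t : ℕ → ℕ) (ht : ∀ m ∈ Finset.Icc 1 M, 2 ^ (m - 1) - 1 ≤ t m)
    (ε : ℕ → ℝ) (hε1 : ε 1 = 1)
    (hεm : ∀ m ∈ Finset.Icc 2 M,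
      ε m = Real.sqrt (a / (t m : ℝ)) + b / (t m : ℝ) + 2 / (T : ℝ)) :
    ∑ m ∈ Finset.Icc 1 M, (H m : ℝ) * ε m ≤
      3 + 4 * Real.sqrt (2 * a * T) + 2 * b * M := by
  obtain ⟨n, rfl⟩ : ∃ n, M = n + 1 := ⟨M - 1, by omega⟩
  have hTpos : (0 : ℝ) < T := by exact_mod_cast hT
  have hHR (m : ℕ) : (H m : ℝ) = 2 ^ (m - 1) := by rw [hH]; push_cast; rfl
  simp only [hHR] at hHsum ⊢
  have hsum := sum_doubling_mul_le ha hb (by positivity) t ε hε1 n ht hεm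
  have hconst : 2 / (T : ℝ) * ∑ m ∈ Finset.Icc 1 (n + 1), (2 : ℝ) ^ (m - 1) ≤ 2 := by
    rw [div_mul_eq_mul_div, div_le_iff₀ hTpos]
    linarith
  have hlast : (2 : ℝ) ^ n ≤ T :=
    (Finset.single_le_sum (f := fun m => (2 : ℝ) ^ (m - 1)) (fun _ _ => by positivity)
      (Finset.mem_Icc.2 ⟨hM, le_rfl⟩)).trans hHsum
  have hsqrt := mul_le_mul_of_nonneg_left (Real.sqrt_le_sqrt hlast) (Real.sqrt_nonneg (2 * a))
  rw [← Real.sqrt_mul (by positivity) (T : ℝ)] at hsqrt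
  push_cast
  linarith
end
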